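/- arXiv:1204.0972 — 2 statements merged into one kernel-verified Lean document; each statement's English description precedes it below -/
import Mathlib

section
/- For every a, b, c, x ∈ ℝ and every n ≥ 1: ψ_n(x|a,b,c,0) = U_n(x) - (a+b+c)·U_{n-1}(x) + (ab+ac+bc)·U_{n-2}(x) - abc·U_{n-3}(x), where U is the ℤ-indexed Chebyshev polynomial of the second kind (so U_{-1} = 0, U_{-2} = -1). -/
open scoped BigOperators

/-- The q-Pochhammer symbol `(a;q)_n = ∏_{j=0}^{n-1} (1 - a q^j)`. -/
noncomputable def qPoch (a q : ℝ) (n : ℕ) : ℝ := ∏ j ∈ Finset.range n, (1 - a * q ^ j)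

/-- Evaluation of the ℤ-indexed Chebyshev polynomial of the second kind. -/
noncomputable def chebU (x : ℝ) (n : ℤ) : ℝ := (Polynomial.Chebyshev.U ℝ n).eval x

/-- The continuous q-Hermite polynomials `h_n(x|q)`. -/
noncomputable def qHermite (q x : ℝ) : ℕ → ℝ
  | 0 => 1
  | 1 => 2 * x
  | n + 2 => 2 * x * qHermite q x (n + 1) - (1 - q ^ (n + 1)) * qHermite q x n

/-- The big q-Hermite polynomials `h_n(x|a,q)`. -/
noncomputable def bigQHermite (a q x : ℝ) : ℕ → ℝ
  | 0 => 1
  | 1 => 2 * x - a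
  | n + 2 => (2 * x - a * q ^ (n + 1)) * bigQHermite a q x (n + 1)
      - (1 - q ^ (n + 1)) * bigQHermite a q x n

/-- The Al-Salam–Chihara polynomials `Q_n(x|a,b,q)`. -/
noncomputable def alSalamChihara (a b q x : ℝ) : ℕ → ℝ
  | 0 => 1
  | 1 => 2 * x - (a + b)
  | n + 2 => (2 * x - (a + b) * q ^ (n + 1)) * alSalamChihara a b q x (n + 1)
      - (1 - a * b * q ^ n) * (1 - q ^ (n + 1)) * alSalamChihara a b q x n

/-- The continuous dual q-Hahn polynomials `ψ_n(x|a,b,c,q)`. -/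
noncomputable def cdqHahn (a b c q x : ℝ) : ℕ → ℝ
  | 0 => 1
  | 1 => 2 * x - (a + b + c) + a * b * c
  | n + 2 =>
      (2 * x - ((a + b + c) * q ^ (n + 1)
          + a * b * c * q ^ n * (1 - q ^ (n + 1) - q ^ (n + 2))))
        * cdqHahn a b c q x (n + 1)
      - (1 - a * b * q ^ n) * (1 - a * c * q ^ n) * (1 - b * c * q ^ n)
          * (1 - q ^ (n + 1)) * cdqHahn a b c q x n

theorem chebU_add_two (x : ℝ) (n : ℤ) :
    chebU x (n + 2) = 2 * x * chebU x (n + 1) - chebU x n := by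
  simp [chebU, Polynomial.Chebyshev.U_add_two]

theorem cdqHahn_zero_add_three (a b c x : ℝ) (n : ℕ) :
    cdqHahn a b c 0 x (n + 3) =
      2 * x * cdqHahn a b c 0 x (n + 2) - cdqHahn a b c 0 x (n + 1) := by
  rw [cdqHahn]
  simp

theorem cdqHahn_at_q_zero (a b c x : ℝ) :
    ∀ n : ℕ, 1 ≤ n →
      cdqHahn a b c 0 x n =
        chebU x n - (a + b + c) * chebU x ((n : ℤ) - 1)
          + (a * b + a * c + b * c) * chebU x ((n : ℤ) - 2)
          - a * b * c * chebU x ((n : ℤ) - 3) := by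
  intro n hn
  induction n using Nat.strong_induction_on with
  | _ n ih =>
    match n, hn with
    | 1, _ => simp [cdqHahn, chebU]
    | 2, _ =>
      simp [cdqHahn, chebU, Polynomial.Chebyshev.U_two]
      ring
    | n + 3, _ =>
      rw [cdqHahn_zero_add_three, ih (n + 2) (by lia) (by lia), ih (n + 1) (by lia) (by lia)]
      have h₀ := chebU_add_two x (n + 1)
      have h₁ := chebU_add_two x n
      have h₂ := chebU_add_two x (n - 1)
      have h₃ := chebU_add_two x (n - 2)
      push_cast
      ring_nf at h₀ h₁ h₂ h₃ ⊢
      rw [h₀, h₁, h₂, h₃]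
      ring
end

section
/- Let -1 < q < 1, let ρ ∈ ℝ with |ρ| < 1, and let ξ : ℕ → ℝ be a sequence such that for every n ≥ 0 the series ∑_{i≥0} (ρ^i/(q)_i)·ξ_{n+i} converges absolutely. For r ∈ ℝ with |r| ≤ |ρ| put σ_n(r) = ∑_{i≥0} (r^i/(q)_i)·ξ_{n+i}. Then for all n ≥ 0 and all m ≥ 1: σ_n(ρ q^m) = σ_n(ρ q^{m-1}) - ρ q^{m-1} · σ_{n+1}(ρ q^{m-1}). -/
open scoped BigOperators

theorem one_sub_pow_succ_ne_zero {q : ℝ} (hq : |q| < 1) (n : ℕ) : 1 - q ^ (n + 1) ≠ 0 := by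
  have h : q ^ (n + 1) < 1 := by
    refine (le_abs_self _).trans_lt ?_
    rw [abs_pow]
    exact pow_lt_one₀ (abs_nonneg q) hq n.succ_ne_zero
  linarith

theorem qPoch_self_succ (q : ℝ) (n : ℕ) :
    qPoch q q (n + 1) = qPoch q q n * (1 - q ^ (n + 1)) := by
  simp only [qPoch, Finset.prod_range_succ, pow_succ']

theorem summable_pow_div_qPoch_mul {q r ρ : ℝ} {ξ : ℕ → ℝ} (hr : |r| ≤ |ρ|)
    (h : Summable fun i : ℕ => |ρ ^ i / qPoch q q i * ξ i|) :
    Summable fun i : ℕ => r ^ i / qPoch q q i * ξ i := by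
  refine Summable.of_norm_bounded h fun i => ?_
  simp only [Real.norm_eq_abs, abs_mul, abs_div, abs_pow]
  gcongr

/-- The `q`-difference equation of the series `∑ r ^ i / (q; q)_i * ξ i` in the variable `r`. -/
theorem tsum_pow_mul_div_qPoch {q r : ℝ} {ξ : ℕ → ℝ} (hq : |q| < 1)
    (h : Summable fun i : ℕ => r ^ i / qPoch q q i * ξ i)
    (hqr : Summable fun i : ℕ => (r * q) ^ i / qPoch q q i * ξ i) :
    ∑' i : ℕ, (r * q) ^ i / qPoch q q i * ξ i =
      ∑' i : ℕ, r ^ i / qPoch q q i * ξ i -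
        r * ∑' i : ℕ, r ^ i / qPoch q q i * ξ (i + 1) := by
  have hdiff : ∑' i : ℕ, (r ^ i / qPoch q q i * ξ i - (r * q) ^ i / qPoch q q i * ξ i) =
      r * ∑' i : ℕ, r ^ i / qPoch q q i * ξ (i + 1) := by
    rw [(h.sub hqr).tsum_eq_zero_add, ← tsum_mul_left]
    simp only [pow_zero, sub_self, zero_add]
    refine tsum_congr fun i => ?_
    have hi := one_sub_pow_succ_ne_zero hq i
    rw [qPoch_self_succ, mul_pow, ← sub_mul, ← sub_div, ← mul_one_sub,
      mul_div_mul_right _ _ hi, pow_succ']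
    ring
  rw [h.tsum_sub hqr] at hdiff
  linarith

theorem sigma_one_step_recursion (q ρ : ℝ) (hq : -1 < q) (hq1 : q < 1) (hρ : |ρ| < 1)
    (ξ : ℕ → ℝ)
    (hsum : ∀ n : ℕ, Summable fun i : ℕ => |ρ ^ i / qPoch q q i * ξ (n + i)|)
    (σ : ℝ → ℕ → ℝ)
    (hσ : ∀ r : ℝ, |r| ≤ |ρ| → ∀ n : ℕ, σ r n = ∑' i : ℕ, r ^ i / qPoch q q i * ξ (n + i)) :
    ∀ n : ℕ, ∀ m : ℕ, 1 ≤ m →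
      σ (ρ * q ^ m) n =
        σ (ρ * q ^ (m - 1)) n - ρ * q ^ (m - 1) * σ (ρ * q ^ (m - 1)) (n + 1) := by
  intro n m hm
  obtain ⟨k, rfl⟩ := Nat.exists_eq_add_of_le' hm
  have hqa : |q| < 1 := abs_lt.2 ⟨hq, hq1⟩
  have hr (j : ℕ) : |ρ * q ^ j| ≤ |ρ| := by
    rw [abs_mul, abs_pow]
    exact mul_le_of_le_one_right (abs_nonneg ρ) (pow_le_one₀ (abs_nonneg q) hqa.le)
  have hs (j : ℕ) := summable_pow_div_qPoch_mul (hr j) (hsum n)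
  have hs' := hs (k + 1)
  rw [Nat.add_sub_cancel, hσ _ (hr _), hσ _ (hr _), hσ _ (hr _)]
  rw [pow_succ, ← mul_assoc] at hs' ⊢
  simpa only [Nat.add_right_comm n 1, ← Nat.add_assoc] using
    tsum_pow_mul_div_qPoch hqa (hs k) hs'
end
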